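/- Let λ = (λ₁ ≥ … ≥ λ_r ≥ 0) be a partition, let Θ ∈ {Γ,Δ}^r with Θ_i ≠ Θ_{i+1} for some 1 ≤ i ≤ r−1, write Θ' = (Θ₁,…,Θ_{r−1}) and let (s_iΘ)' = ((s_iΘ)₁,…,(s_iΘ)_{r−1}), where s_iΘ is Θ with entries i and i+1 interchanged. Then: (a) the Berenstein–Kirillov involution t_{r−i} maps GTP^{Θ'}_{λ+ρ} bijectively onto GTP^{(s_iΘ)'}_{λ+ρ}; and (b) for every 𝔗 ∈ GTP_λ, t_{r−i}(sh_{Θ'}(𝔗)) = sh_{(s_iΘ)'}(t_{r−i}(𝔗)). -/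

import Mathlib

namespace GTP

/-- Row-pair types: `Γ` (left-strict) and `Δ` (right-strict). -/
inductive GD | G | D
deriving DecidableEq

/-- A triangular array, encoded as a function `ℕ → ℕ → ℕ` vanishing outside the triangle,
is a Gelfand–Tsetlin pattern with `r` rows if the interlacing inequalities hold. -/
def IsGTP (r : ℕ) (a : ℕ → ℕ → ℕ) : Prop :=
  (∀ i j, (j < i ∨ r ≤ j) → a i j = 0) ∧
  (∀ i j, 1 ≤ i → i ≤ j → j < r → a (i - 1) (j - 1) ≥ a i j ∧ a i j ≥ a (i - 1) j)

/-- The row-pair `(i−1, i)` is left-strict (type `Γ`). -/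
def RowPairG (r : ℕ) (a : ℕ → ℕ → ℕ) (i : ℕ) : Prop :=
  ∀ j, i ≤ j → j < r → a (i - 1) (j - 1) > a i j ∧ a i j ≥ a (i - 1) j

/-- The row-pair `(i−1, i)` is right-strict (type `Δ`). -/
def RowPairD (r : ℕ) (a : ℕ → ℕ → ℕ) (i : ℕ) : Prop :=
  ∀ j, i ≤ j → j < r → a (i - 1) (j - 1) ≥ a i j ∧ a i j > a (i - 1) j

/-- The set `GTP_μ` of Gelfand–Tsetlin patterns with top row `μ`. -/
def setGTP (r : ℕ) (μ : ℕ → ℕ) : Set (ℕ → ℕ → ℕ) :=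
  {a | IsGTP r a ∧ ∀ j, j < r → a 0 j = μ j}

/-- The set `GTP^{Θ'}_μ` of patterns in `GTP_μ` whose row-pair `(i−1, i)` has type `Θ'_i`
for every `1 ≤ i ≤ r−1`. -/
def setGTPTyped (r : ℕ) (Θ' : ℕ → GD) (μ : ℕ → ℕ) : Set (ℕ → ℕ → ℕ) :=
  {a | IsGTP r a ∧ (∀ j, j < r → a 0 j = μ j) ∧
    ∀ i, 1 ≤ i → i < r →
      ((Θ' i = GD.G → RowPairG r a i) ∧ (Θ' i = GD.D → RowPairD r a i))}

/-- The minimal pattern `ρ^{Θ'}` (raw recursion on the row index). -/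
def rhoRaw (r : ℕ) (Θ' : ℕ → GD) : ℕ → ℕ → ℕ
  | 0, j => r - 1 - j
  | i + 1, j =>
      match Θ' (i + 1) with
      | GD.G => rhoRaw r Θ' i j
      | GD.D => rhoRaw r Θ' i (j - 1)

/-- The triangular array `ρ^{Θ'}`, vanishing outside the triangle. -/
def rhoArr (r : ℕ) (Θ' : ℕ → GD) (i j : ℕ) : ℕ :=
  if i ≤ j ∧ j < r then rhoRaw r Θ' i j else 0

/-- The shift map `sh_{Θ'} : 𝔗 ↦ 𝔗 + ρ^{Θ'}` (entrywise sum). -/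
def shMap (r : ℕ) (Θ' : ℕ → GD) (a : ℕ → ℕ → ℕ) : ℕ → ℕ → ℕ :=
  fun i j => a i j + rhoArr r Θ' i j

/-- The new value of the entry `a_{i,j}` under the Berenstein–Kirillov involution `t_{r−i}`
(which acts on row `i`), with the boundary omissions when `j = i` and `j = r−1`. -/
def bkEntry (r : ℕ) (a : ℕ → ℕ → ℕ) (i j : ℕ) : ℕ :=
  (if j = i then a (i - 1) (j - 1) else min (a (i - 1) (j - 1)) (a (i + 1) j)) +
    (if j = r - 1 then a (i - 1) j else max (a (i - 1) j) (a (i + 1) (j + 1))) - a i j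

/-- The Berenstein–Kirillov involution `t_{r−i}`, acting on row `i` of a triangular array
with `r` rows. -/
def bkMap (r i : ℕ) (a : ℕ → ℕ → ℕ) : ℕ → ℕ → ℕ :=
  fun i' j => if i' = i ∧ i ≤ j ∧ j < r then bkEntry r a i j else a i' j

/-- `Θ` with the entries in positions `i` and `i+1` interchanged. -/
def swapAt (Θ : ℕ → GD) (i : ℕ) : ℕ → GD :=
  fun j => if j = i then Θ (i + 1) else if j = i + 1 then Θ i else Θ j

theorem GD.eq_G_or_eq_D (x : GD) : x = GD.G ∨ x = GD.D := by
  cases x <;> simp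

theorem swapAt_left (Θ : ℕ → GD) (i : ℕ) : swapAt Θ i i = Θ (i + 1) := by
  simp [swapAt]

theorem swapAt_right (Θ : ℕ → GD) (i : ℕ) : swapAt Θ i (i + 1) = Θ i := by
  simp [swapAt]

theorem swapAt_of_ne (Θ : ℕ → GD) {i k : ℕ} (h : k ≠ i) (h' : k ≠ i + 1) :
    swapAt Θ i k = Θ k := by
  simp [swapAt, h, h']

theorem swapAt_swapAt (Θ : ℕ → GD) (i : ℕ) : swapAt (swapAt Θ i) i = Θ := by
  funext k
  simp only [swapAt]
  grind

theorem bkMap_of_ne (r : ℕ) {i k : ℕ} (h : k ≠ i) (a : ℕ → ℕ → ℕ) : bkMap r i a k = a k := by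
  funext j
  simp [bkMap, h]

theorem bkMap_self (r : ℕ) {i j : ℕ} (hij : i ≤ j) (hj : j < r) (a : ℕ → ℕ → ℕ) :
    bkMap r i a i j = bkEntry r a i j := by
  simp [bkMap, hij, hj]

/-- An entry of row `i` and its image under the Berenstein–Kirillov involution are mirror images
in the interval left to that entry by its neighbours in rows `i - 1` and `i + 1`. -/
theorem IsGTP.bkEntry_add {r : ℕ} {a : ℕ → ℕ → ℕ} (ha : IsGTP r a) {i j : ℕ} (hi : 1 ≤ i)
    (hij : i ≤ j) (hj : j < r) :
    bkEntry r a i j + a i j =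
      (if j = i then a (i - 1) (j - 1) else min (a (i - 1) (j - 1)) (a (i + 1) j)) +
        (if j = r - 1 then a (i - 1) j else max (a (i - 1) j) (a (i + 1) (j + 1))) := by
  have h₁ := ha.2 i j hi hij hj
  have h₂ := ha.2 (i + 1) j (by omega)
  simp only [Nat.add_sub_cancel] at h₂
  unfold bkEntry
  split_ifs <;> omega

/-- The Berenstein–Kirillov involution squares to the identity on Gelfand–Tsetlin patterns. -/
theorem IsGTP.bkMap_bkMap {r : ℕ} {a : ℕ → ℕ → ℕ} (ha : IsGTP r a) {i : ℕ} (hi : 1 ≤ i) :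
    bkMap r i (bkMap r i a) = a := by
  funext k j
  by_cases hk : k = i
  · subst hk
    by_cases hj : k ≤ j ∧ j < r
    · have h := ha.bkEntry_add hi hj.1 hj.2
      rw [bkMap_self r hj.1 hj.2, bkEntry, bkMap_of_ne r (show k - 1 ≠ k by omega),
        bkMap_of_ne r (show k + 1 ≠ k by omega), bkMap_self r hj.1 hj.2]
      omega
    · simp [bkMap, hj]
  · rw [bkMap_of_ne r hk, bkMap_of_ne r hk]

theorem RowPairG.rowPairs_bkMap {r : ℕ} {a : ℕ → ℕ → ℕ} (ha : IsGTP r a) {i : ℕ} (hi : 1 ≤ i)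
    (h : RowPairG r a i) (h' : i + 1 < r → RowPairD r a (i + 1)) :
    RowPairD r (bkMap r i a) i ∧ RowPairG r (bkMap r i a) (i + 1) := by
  have key : ∀ j, i ≤ j → j < r → bkEntry r a i j ≤ a (i - 1) (j - 1) ∧
      a (i - 1) j < bkEntry r a i j ∧ (j ≠ i → bkEntry r a i j ≤ a (i + 1) j) ∧
      (j + 1 < r → a (i + 1) (j + 1) < bkEntry r a i j) := by
    intro j hij hj
    have e := ha.bkEntry_add hi hij hj
    have h₁ := h j hij hj
    have h₂ : i + 1 ≤ j → a i j < a (i + 1) j := fun hj' =>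
      (h' (by omega) j hj' hj).2
    have h₃ : j + 1 < r → a (i + 1) (j + 1) ≤ a i j := fun hj' =>
      (h' (by omega) (j + 1) (by omega) hj').1
    split_ifs at e <;> omega
  constructor
  · intro j hij hj
    have := key j hij hj
    rw [bkMap_self r hij hj, bkMap_of_ne r (show i - 1 ≠ i by omega)]
    omega
  · intro j hij hj
    obtain ⟨k, rfl⟩ : ∃ k, j = k + 1 := ⟨j - 1, by omega⟩
    have h₁ := key k (by omega) (by omega)
    have h₂ := key (k + 1) (by omega) hj
    simp only [Nat.add_sub_cancel]
    rw [bkMap_self r (by omega) hj, bkMap_self r (by omega) (by omega),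
      bkMap_of_ne r (show i + 1 ≠ i by omega)]
    omega

theorem RowPairD.rowPairs_bkMap {r : ℕ} {a : ℕ → ℕ → ℕ} (ha : IsGTP r a) {i : ℕ} (hi : 1 ≤ i)
    (h : RowPairD r a i) (h' : i + 1 < r → RowPairG r a (i + 1)) :
    RowPairG r (bkMap r i a) i ∧ RowPairD r (bkMap r i a) (i + 1) := by
  have key : ∀ j, i ≤ j → j < r → bkEntry r a i j < a (i - 1) (j - 1) ∧
      a (i - 1) j ≤ bkEntry r a i j ∧ (j ≠ i → bkEntry r a i j < a (i + 1) j) ∧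
      (j + 1 < r → a (i + 1) (j + 1) ≤ bkEntry r a i j) := by
    intro j hij hj
    have e := ha.bkEntry_add hi hij hj
    have h₁ := h j hij hj
    have h₂ : i + 1 ≤ j → a i j ≤ a (i + 1) j := fun hj' =>
      (h' (by omega) j hj' hj).2
    have h₃ : j + 1 < r → a (i + 1) (j + 1) < a i j := fun hj' =>
      (h' (by omega) (j + 1) (by omega) hj').1
    split_ifs at e <;> omega
  constructor
  · intro j hij hj
    have := key j hij hj
    rw [bkMap_self r hij hj, bkMap_of_ne r (show i - 1 ≠ i by omega)]
    omega
  · intro j hij hj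
    obtain ⟨k, rfl⟩ : ∃ k, j = k + 1 := ⟨j - 1, by omega⟩
    have h₁ := key k (by omega) (by omega)
    have h₂ := key (k + 1) (by omega) hj
    simp only [Nat.add_sub_cancel]
    rw [bkMap_self r (by omega) hj, bkMap_self r (by omega) (by omega),
      bkMap_of_ne r (show i + 1 ≠ i by omega)]
    omega

/-- A triangular array whose row-pairs all have prescribed types interlaces. -/
theorem isGTP_of_rowPairs {r : ℕ} {Θ : ℕ → GD} {a : ℕ → ℕ → ℕ}
    (h₀ : ∀ i j, (j < i ∨ r ≤ j) → a i j = 0)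
    (h : ∀ i, 1 ≤ i → i < r →
      ((Θ i = GD.G → RowPairG r a i) ∧ (Θ i = GD.D → RowPairD r a i))) : IsGTP r a := by
  refine ⟨h₀, fun i j hi hij hj => ?_⟩
  have h' := h i hi (by omega)
  rcases (Θ i).eq_G_or_eq_D with hΘ | hΘ
  · exact ⟨(h'.1 hΘ j hij hj).1.le, (h'.1 hΘ j hij hj).2⟩
  · exact ⟨(h'.2 hΘ j hij hj).1, (h'.2 hΘ j hij hj).2.le⟩

theorem mapsTo_bkMap_setGTPTyped (r : ℕ) (μ : ℕ → ℕ) (Θ : ℕ → GD) {i : ℕ} (hi : 1 ≤ i)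
    (hir : i < r) (hΘ : Θ i ≠ Θ (i + 1)) :
    Set.MapsTo (bkMap r i) (setGTPTyped r Θ μ) (setGTPTyped r (swapAt Θ i) μ) := by
  rintro a ⟨ha, htop, htype⟩
  have hrows : ∀ k, 1 ≤ k → k < r →
      ((swapAt Θ i k = GD.G → RowPairG r (bkMap r i a) k) ∧
        (swapAt Θ i k = GD.D → RowPairD r (bkMap r i a) k)) := by
    intro k hk hkr
    have hi' := htype i hi hir
    have hsucc := htype (i + 1) (by omega)
    by_cases hki : k = i ∨ k = i + 1
    · rcases (Θ i).eq_G_or_eq_D with h | h <;>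
        rcases (Θ (i + 1)).eq_G_or_eq_D with h' | h'
      · simp [h, h'] at hΘ
      · have := (hi'.1 h).rowPairs_bkMap ha hi fun hr => (hsucc hr).2 h'
        rcases hki with rfl | rfl
        · simp [swapAt_left, h', this.1]
        · simp [swapAt_right, h, this.2]
      · have := (hi'.2 h).rowPairs_bkMap ha hi fun hr => (hsucc hr).1 h'
        rcases hki with rfl | rfl
        · simp [swapAt_left, h', this.1]
        · simp [swapAt_right, h, this.2]
      · simp [h, h'] at hΘ
    · rw [not_or] at hki
      rw [swapAt_of_ne Θ hki.1 hki.2]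
      simpa only [RowPairG, RowPairD, bkMap_of_ne r hki.1,
        bkMap_of_ne r (show k - 1 ≠ i by omega)] using htype k hk hkr
  refine ⟨isGTP_of_rowPairs (fun k j hkj => ?_) hrows, fun j hj => ?_, hrows⟩
  · have : ¬(k = i ∧ i ≤ j ∧ j < r) := by omega
    simp only [bkMap, this, if_false]
    exact ha.1 k j hkj
  · rw [bkMap_of_ne r (show 0 ≠ i by omega)]
    exact htop j hj

theorem bijOn_bkMap_setGTPTyped (r : ℕ) (μ : ℕ → ℕ) (Θ : ℕ → GD) {i : ℕ} (hi : 1 ≤ i)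
    (hir : i < r) (hΘ : Θ i ≠ Θ (i + 1)) :
    Set.BijOn (bkMap r i) (setGTPTyped r Θ μ) (setGTPTyped r (swapAt Θ i) μ) := by
  refine Set.InvOn.bijOn (f' := bkMap r i)
    ⟨fun a ha => ha.1.bkMap_bkMap hi, fun a ha => ha.1.bkMap_bkMap hi⟩
    (mapsTo_bkMap_setGTPTyped r μ Θ hi hir hΘ) ?_
  have h := mapsTo_bkMap_setGTPTyped r μ (swapAt Θ i) hi hir
    (by rw [swapAt_left, swapAt_right]; exact hΘ.symm)
  rwa [swapAt_swapAt] at h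

/-- The number of `Δ`s among the first `i` row-pair types. -/
def countD (Θ : ℕ → GD) (i : ℕ) : ℕ := ∑ k ∈ Finset.range i, if Θ (k + 1) = GD.D then 1 else 0

theorem countD_succ (Θ : ℕ → GD) (i : ℕ) :
    countD Θ (i + 1) = countD Θ i + if Θ (i + 1) = GD.D then 1 else 0 :=
  Finset.sum_range_succ _ _

theorem rhoRaw_eq (r : ℕ) (Θ : ℕ → GD) {i j : ℕ} (hij : i ≤ j) (hj : j < r) :
    rhoRaw r Θ i j = r - 1 - j + countD Θ i := by
  induction i generalizing j with
  | zero => simp [rhoRaw, countD]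
  | succ i ih =>
    rw [countD_succ]
    rcases (Θ (i + 1)).eq_G_or_eq_D with h | h
    · simp only [rhoRaw, h]
      rw [ih (by omega) hj]
      simp
    · simp only [rhoRaw, h]
      rw [ih (by omega) (by omega)]
      simp only [if_true]
      omega

theorem rhoArr_eq (r : ℕ) (Θ : ℕ → GD) {i j : ℕ} (hij : i ≤ j) (hj : j < r) :
    rhoArr r Θ i j = r - 1 - j + countD Θ i := by
  rw [rhoArr, if_pos ⟨hij, hj⟩, rhoRaw_eq r Θ hij hj]

theorem countD_swapAt (Θ : ℕ → GD) {i k : ℕ} (hi : 1 ≤ i) (hk : k ≠ i) :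
    countD (swapAt Θ i) k = countD Θ k := by
  rcases lt_or_gt_of_ne hk with hlt | hgt
  · refine Finset.sum_congr rfl fun l hl => ?_
    rw [Finset.mem_range] at hl
    rw [swapAt_of_ne Θ (by omega) (by omega)]
  · obtain ⟨m, rfl⟩ : ∃ m, i = m + 1 := ⟨i - 1, by omega⟩
    induction k, hgt using Nat.le_induction with
    | base =>
      have h : countD (swapAt Θ (m + 1)) m = countD Θ m :=
        Finset.sum_congr rfl fun l hl => by
          rw [Finset.mem_range] at hl
          rw [swapAt_of_ne Θ (by omega) (by omega)]
      simp only [countD_succ, h, swapAt_left, swapAt_right]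
      omega
    | succ k hk' ih =>
      rw [countD_succ, countD_succ, ih (by omega), swapAt_of_ne Θ (by omega) (by omega)]

theorem rhoArr_swapAt (r : ℕ) (Θ : ℕ → GD) {i k : ℕ} (hi : 1 ≤ i) (hk : k ≠ i) (j : ℕ) :
    rhoArr r (swapAt Θ i) k j = rhoArr r Θ k j := by
  by_cases h : k ≤ j ∧ j < r
  · rw [rhoArr_eq r _ h.1 h.2, rhoArr_eq r _ h.1 h.2, countD_swapAt Θ hi hk]
  · simp [rhoArr, h]

theorem IsGTP.bkEntry_shMap {r : ℕ} {a : ℕ → ℕ → ℕ} (ha : IsGTP r a) (Θ : ℕ → GD) {i j : ℕ}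
    (hi : 1 ≤ i) (hΘ : Θ i ≠ Θ (i + 1)) (hij : i ≤ j) (hj : j < r) :
    bkEntry r (shMap r Θ a) i j = bkEntry r a i j + rhoArr r (swapAt Θ i) i j := by
  have e := ha.bkEntry_add hi hij hj
  obtain ⟨m, rfl⟩ : ∃ m, i = m + 1 := ⟨i - 1, by omega⟩
  have hm : countD (swapAt Θ (m + 1)) m = countD Θ m := countD_swapAt Θ hi (by omega)
  have c₁ := countD_succ Θ m
  have c₂ := countD_succ Θ (m + 1)
  have c₃ := countD_succ (swapAt Θ (m + 1)) m
  rw [swapAt_left, hm] at c₃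
  have hsum : countD Θ (m + 1) + countD (swapAt Θ (m + 1)) (m + 1) = 2 * countD Θ m + 1 ∧
      countD Θ (m + 1 + 1) = countD Θ m + 1 := by
    rcases (Θ (m + 1)).eq_G_or_eq_D with h | h <;>
      rcases (Θ (m + 1 + 1)).eq_G_or_eq_D with h' | h' <;>
      simp [h, h'] at hΘ c₁ c₂ c₃ <;> omega
  obtain ⟨c, hc⟩ : ∃ c, c = r - 1 - j + countD Θ m := ⟨_, rfl⟩
  have p₁ : rhoArr r Θ m (j - 1) = c + 1 := by
    rw [rhoArr_eq r Θ (by omega) (by omega)]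
    omega
  have p₂ : rhoArr r Θ m j = c := by
    rw [rhoArr_eq r Θ (by omega) hj, hc]
  have p₃ : rhoArr r Θ (m + 1) j + rhoArr r (swapAt Θ (m + 1)) (m + 1) j = 2 * c + 1 := by
    rw [rhoArr_eq r Θ hij hj, rhoArr_eq r _ hij hj]
    omega
  have p₄ : j ≠ m + 1 → rhoArr r Θ (m + 1 + 1) j = c + 1 := fun h => by
    rw [rhoArr_eq r Θ (by omega) hj]
    omega
  have p₅ : j ≠ r - 1 → rhoArr r Θ (m + 1 + 1) (j + 1) = c := fun h => by
    rw [rhoArr_eq r Θ (by omega) (by omega)]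
    omega
  have upper : (if j = m + 1 then shMap r Θ a m (j - 1) else
      min (shMap r Θ a m (j - 1)) (shMap r Θ a (m + 1 + 1) j)) =
      (if j = m + 1 then a m (j - 1) else min (a m (j - 1)) (a (m + 1 + 1) j)) + (c + 1) := by
    simp only [shMap, p₁]
    split_ifs with h
    · rfl
    · rw [p₄ h, Nat.add_min_add_right]
  have lower : (if j = r - 1 then shMap r Θ a m j else
      max (shMap r Θ a m j) (shMap r Θ a (m + 1 + 1) (j + 1))) =
      (if j = r - 1 then a m j else max (a m j) (a (m + 1 + 1) (j + 1))) + c := by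
    simp only [shMap, p₂]
    split_ifs with h
    · rfl
    · rw [p₅ h, Nat.add_max_add_right]
  simp only [Nat.add_sub_cancel] at e
  rw [bkEntry, Nat.add_sub_cancel, upper, lower, shMap]
  omega

/-- The Berenstein–Kirillov involution `t_{r−i}` maps
`GTP^{Θ'}_{λ+ρ}` bijectively onto `GTP^{(s_iΘ)'}_{λ+ρ}`, and it intertwines the shift
maps `sh_{Θ'}` and `sh_{(s_iΘ)'}`. -/
theorem bk_typed_bijOn_and_sh_comm (r : ℕ) (hr : 1 ≤ r) (lam : ℕ → ℕ)
    (hlam : ∀ j k, j ≤ k → k < r → lam k ≤ lam j)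
    (Θ : ℕ → GD) (i : ℕ) (hi1 : 1 ≤ i) (hir : i < r) (hΘ : Θ i ≠ Θ (i + 1)) :
    Set.BijOn (bkMap r i)
        (setGTPTyped r Θ (fun j => lam j + (r - 1 - j)))
        (setGTPTyped r (swapAt Θ i) (fun j => lam j + (r - 1 - j))) ∧
    ∀ a ∈ setGTP r lam, bkMap r i (shMap r Θ a) = shMap r (swapAt Θ i) (bkMap r i a) := by
  refine ⟨bijOn_bkMap_setGTPTyped r _ Θ hi1 hir hΘ, fun a ha => ?_⟩
  funext k j
  by_cases hk : k = i
  · subst hk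
    by_cases hj : k ≤ j ∧ j < r
    · rw [bkMap_self r hj.1 hj.2, ha.1.bkEntry_shMap Θ hi1 hΘ hj.1 hj.2, shMap,
        bkMap_self r hj.1 hj.2]
    · simp [bkMap, shMap, rhoArr, hj]
  · simp only [bkMap_of_ne r hk, shMap, rhoArr_swapAt r Θ hi1 hk]

end GTP
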